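/- arXiv:1103.1764 — 2 statements merged into one kernel-verified Lean document; each statement's English description precedes it below -/
import Mathlib

section
/- Let G be a finite connected simple graph in which every vertex has degree 3 and which has no bridges. If e_1 and e_2 are two distinct edges of G sharing a common vertex, then the graph obtained from G by deleting the edges e_1 and e_2 is still connected. -/
/-- An edge `e` of a graph `G` is a *bridge* if deleting `e` from `G` (keeping all
vertices) disconnects `G`. -/
def IsBridgeEdge {V : Type*} (G : SimpleGraph V) (e : Sym2 V) : Prop :=
  e ∈ G.edgeSet ∧ ¬ (G.deleteEdges {e}).Connected

theorem SimpleGraph.Reachable.of_adj_closed {V : Type*} {G : SimpleGraph V} {P : V → Prop}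
    (hP : ∀ x y, G.Adj x y → P x → P y) {u w : V} (h : G.Reachable u w) (hu : P u) : P w := by
  obtain ⟨p⟩ := h
  induction p with
  | nil => exact hu
  | cons hadj _ ih => exact ih (hP _ _ hadj hu)

/-- If `G` stays connected without `e`, and `b` can be reached from `v` using neither `e` nor `vb`,
then `G` stays connected without both edges. -/
theorem SimpleGraph.connected_deleteEdges_pair_of_reachable {V : Type*} {G : SimpleGraph V}
    {v b : V} {e : Sym2 V} (hconn : (G.deleteEdges {e}).Connected)
    (hb : (G.deleteEdges {e, s(v, b)}).Reachable v b) :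
    (G.deleteEdges {e, s(v, b)}).Connected := by
  refine (SimpleGraph.connected_iff_exists_forall_reachable _).2 ⟨v, fun w ↦ ?_⟩
  refine (hconn.preconnected v w).of_adj_closed
    (P := (G.deleteEdges {e, s(v, b)}).Reachable v) (fun x y hxy hx ↦ ?_) .rfl
  by_cases hvb : s(x, y) = s(v, b)
  · rcases Sym2.eq_iff.1 hvb with ⟨rfl, rfl⟩ | ⟨rfl, rfl⟩
    · exact hb
    · exact .rfl
  · refine hx.trans (SimpleGraph.Adj.reachable ?_)
    simp only [SimpleGraph.deleteEdges_adj, Set.mem_insert_iff, Set.mem_singleton_iff] at hxy ⊢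
    tauto

/-- In a finite connected cubic (3-regular) simple graph without bridges, deleting two
distinct edges sharing a common vertex leaves the graph connected. -/
theorem deleteEdges_adjacent_pair_connected {V : Type*} [Fintype V]
    (G : SimpleGraph V) [DecidableRel G.Adj]
    (hconn : G.Connected) (hdeg : ∀ v : V, G.degree v = 3)
    (hbridge : ∀ e : Sym2 V, ¬ IsBridgeEdge G e)
    (e₁ e₂ : Sym2 V) (he₁ : e₁ ∈ G.edgeSet) (he₂ : e₂ ∈ G.edgeSet) (hne : e₁ ≠ e₂)
    (hshare : ∃ v : V, v ∈ e₁ ∧ v ∈ e₂) :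
    (G.deleteEdges {e₁, e₂}).Connected := by
  classical
  have hdel : ∀ e ∈ G.edgeSet, (G.deleteEdges {e}).Connected := fun e he ↦ by
    by_contra h
    exact hbridge e ⟨he, h⟩
  obtain ⟨v, ⟨a, rfl⟩, ⟨b, rfl⟩⟩ := hshare
  have hva : G.Adj v a := he₁
  have hvb : G.Adj v b := he₂
  have hab : a ≠ b := fun h ↦ hne (by rw [h])
  by_cases hb : (G.deleteEdges {s(v, a), s(v, b)}).Reachable v b
  · exact SimpleGraph.connected_deleteEdges_pair_of_reachable (hdel _ he₁) hb
  by_cases ha : (G.deleteEdges {s(v, a), s(v, b)}).Reachable v a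
  · rw [Set.pair_comm] at ha ⊢
    exact SimpleGraph.connected_deleteEdges_pair_of_reachable (hdel _ he₂) ha
  obtain ⟨c, hvc, hca, hcb, hnbr⟩ :
      ∃ c, G.Adj v c ∧ c ≠ a ∧ c ≠ b ∧ ∀ x, G.Adj v x → x = a ∨ x = b ∨ x = c := by
    have hcard : (((G.neighborFinset v).erase a).erase b).card = 1 := by
      rw [Finset.card_erase_of_mem (by simp [hvb, hab.symm]),
        Finset.card_erase_of_mem (by simpa using hva), SimpleGraph.card_neighborFinset_eq_degree,
        hdeg]
    obtain ⟨c, hc⟩ := Finset.card_eq_one.1 hcard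
    have hmem : ∀ x, (x ≠ b ∧ x ≠ a ∧ G.Adj v x) ↔ x = c := fun x ↦ by
      simpa using Finset.ext_iff.1 hc x
    obtain ⟨hcb, hca, hvc⟩ := (hmem c).2 rfl
    refine ⟨c, hvc, hca, hcb, fun x hx ↦ ?_⟩
    have := hmem x
    tauto
  have hc : (G.deleteEdges {s(v, a), s(v, b)}).Reachable v c :=
    SimpleGraph.Adj.reachable (by
      simp only [SimpleGraph.deleteEdges_adj, Set.mem_insert_iff, Set.mem_singleton_iff,
        Sym2.congr_right]
      tauto)
  -- The component of `v`, with `v` itself removed, has no edge to the outside except `vc`.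
  refine absurd rfl (((hdel s(v, c) hvc).preconnected c v).of_adj_closed
    (P := fun x ↦ (G.deleteEdges {s(v, a), s(v, b)}).Reachable v x ∧ x ≠ v)
    (fun x y hxy ⟨hx, hxv⟩ ↦ ?_) ⟨hc, hvc.ne'⟩).2
  simp only [SimpleGraph.deleteEdges_adj, Set.mem_singleton_iff] at hxy
  have hyv : y ≠ v := by
    rintro rfl
    rcases hnbr x hxy.1.symm with rfl | rfl | rfl
    · exact ha hx
    · exact hb hx
    · exact hxy.2 Sym2.eq_swap
  refine ⟨hx.trans (SimpleGraph.Adj.reachable ?_), hyv⟩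
  simp only [SimpleGraph.deleteEdges_adj, Set.mem_insert_iff, Set.mem_singleton_iff, Sym2.eq_iff]
  tauto
end

section
/- Let G be a finite connected simple graph in which every vertex has degree 3, let v be a vertex of G, and let e_1, e_2 be two distinct edges of G incident to v. If deleting e_1 and e_2 from G disconnects G, then at least one of the three edges of G incident to v is a bridge of G. -/
/-- In a connected graph, some edge leaves every nonempty proper set of vertices. -/
theorem SimpleGraph.Connected.exists_adj_mem_notMem {V : Type*} {H : SimpleGraph V}
    (hH : H.Connected) {S : Set V} {x y : V} (hx : x ∈ S) (hy : y ∉ S) :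
    ∃ u w, u ∈ S ∧ w ∉ S ∧ H.Adj u w := by
  obtain ⟨p⟩ := hH.preconnected x y
  obtain ⟨d, -, h₁, h₂⟩ := p.exists_boundary_dart S hx hy
  exact ⟨d.fst, d.snd, h₁, h₂, d.adj⟩

/-- At a vertex of degree three, two distinct neighbours leave one further neighbour. -/
theorem SimpleGraph.exists_third_neighbor {V : Type*} (G : SimpleGraph V) (v : V)
    [Fintype (G.neighborSet v)] (hdeg : G.degree v = 3) {a b : V} (ha : G.Adj v a)
    (hb : G.Adj v b) (hab : a ≠ b) :
    ∃ c, G.Adj v c ∧ c ≠ a ∧ c ≠ b ∧ ∀ w, G.Adj v w → w = a ∨ w = b ∨ w = c := by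
  classical
  obtain ⟨x, y, z, hxy, hxz, hyz, h⟩ := Finset.card_eq_three.mp hdeg
  have hmem : ∀ w, G.Adj v w ↔ w = x ∨ w = y ∨ w = z := fun w => by
    rw [← G.mem_neighborFinset, h]; simp
  have hx := (hmem x).mpr (.inl rfl)
  have hy := (hmem y).mpr (.inr (.inl rfl))
  have hz := (hmem z).mpr (.inr (.inr rfl))
  grind

/-- In a finite connected cubic (3-regular) simple graph, if deleting two distinct
edges incident to a common vertex `v` disconnects the graph, then at least one of the
edges of `G` incident to `v` is a bridge. -/
theorem bridge_at_vertex_of_deleteEdges_disconnected {V : Type*} [Fintype V]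
    (G : SimpleGraph V) [DecidableRel G.Adj]
    (hconn : G.Connected) (hdeg : ∀ v : V, G.degree v = 3)
    (v : V) (e₁ e₂ : Sym2 V) (he₁ : e₁ ∈ G.edgeSet) (he₂ : e₂ ∈ G.edgeSet)
    (hne : e₁ ≠ e₂) (hv₁ : v ∈ e₁) (hv₂ : v ∈ e₂)
    (hdisc : ¬ (G.deleteEdges {e₁, e₂}).Connected) :
    ∃ e : Sym2 V, e ∈ G.edgeSet ∧ v ∈ e ∧ IsBridgeEdge G e := by
  by_contra hno
  have hdel : ∀ w, G.Adj v w → (G.deleteEdges {s(v, w)}).Connected := fun w hw => by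
    by_contra hc
    exact hno ⟨s(v, w), hw, Sym2.mem_mk_left v w, hw, hc⟩
  obtain ⟨a, rfl⟩ := Sym2.mem_iff_exists.mp hv₁
  obtain ⟨b, rfl⟩ := Sym2.mem_iff_exists.mp hv₂
  have ha : G.Adj v a := he₁
  have hb : G.Adj v b := he₂
  have hab : a ≠ b := fun h => hne (h ▸ rfl)
  obtain ⟨c, hc, hca, hcb, hcw⟩ := G.exists_third_neighbor v (hdeg v) ha hb hab
  set H := G.deleteEdges {s(v, a), s(v, b)}
  set S : Set V := {x | H.Reachable v x}
  have hvS : v ∈ S := SimpleGraph.Reachable.refl v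
  obtain ⟨y, hy⟩ : ∃ y, y ∉ S := by
    by_contra! hall
    exact hdisc ((SimpleGraph.connected_iff_exists_forall_reachable H).mpr ⟨v, hall⟩)
  -- The only edges leaving the component of `v` are the two deleted ones.
  have hcross : ∀ u w, u ∈ S → w ∉ S → G.Adj u w → u = v ∧ (w = a ∨ w = b) := by
    intro u w hu hw huw
    have hmem : s(u, w) = s(v, a) ∨ s(u, w) = s(v, b) := by
      by_contra hn
      exact hw (hu.trans (SimpleGraph.Adj.reachable
        (SimpleGraph.deleteEdges_adj.mpr ⟨huw, by simpa using hn⟩)))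
    simp only [Sym2.eq_iff] at hmem
    grind
  have haS : a ∉ S := by
    obtain ⟨u, w, hu, hw, huw⟩ := (hdel b hb).exists_adj_mem_notMem hvS hy
    rw [SimpleGraph.deleteEdges_adj] at huw
    grind
  have hbS : b ∉ S := by
    obtain ⟨u, w, hu, hw, huw⟩ := (hdel a ha).exists_adj_mem_notMem hvS hy
    rw [SimpleGraph.deleteEdges_adj] at huw
    grind
  have hcS : c ∈ S := by
    by_contra hcS
    rcases (hcross v c hvS hcS hc).2 with h | h <;> grind
  obtain ⟨u, w, ⟨hu, huv⟩, hw, huw⟩ := (hdel c hc).exists_adj_mem_notMem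
    (S := S \ {v}) (x := c) (y := v) ⟨hcS, hc.ne'⟩ (by simp)
  rw [SimpleGraph.deleteEdges_adj] at huw
  obtain ⟨huw, hne'⟩ := huw
  have hwv : w = v := by
    by_contra hwv
    exact huv (hcross u w hu (fun h => hw ⟨h, hwv⟩) huw).1
  subst hwv
  rcases hcw u huw.symm with rfl | rfl | rfl
  · exact haS hu
  · exact hbS hu
  · exact hne' Sym2.eq_swap
end
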